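/- For every α > 0 and t > 0, the following identity holds, expressing the variance of the Riemann–Liouville fractional integral of order α of the generalized counting process: (2/Γ(α)²) ∫_0^t ∫_s^t (t−s)^{α−1}(t−w)^{α−1} (c₂ s + c₁² s w) dw ds − (c₁ t^{α+1}/Γ(α+2))² = c₂ t^{2α+1}/((2α+1) Γ(α+1)²). -/

import Mathlib

noncomputable section
open MeasureTheory Real Finset

lemma aux_inner (α t u C D : ℝ) (hα : 0 < α) (hu : 0 < u) :
    (∫ w in (t - u)..t, (t - w) ^ (α - 1) * (C + D * w)) =
      (C + D * t) * (u ^ α / α) - D * (u ^ (α + 1) / (α + 1)) := by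
  have h1 := intervalIntegral.integral_comp_sub_left (a := t - u) (b := t)
    (fun v : ℝ => v ^ (α - 1) * (C + D * (t - v))) t
  simp only [sub_sub_cancel, sub_self] at h1
  rw [h1]
  have h2 : (∫ v in (0:ℝ)..u, v ^ (α - 1) * (C + D * (t - v))) =
      ∫ v in (0:ℝ)..u, ((C + D * t) * v ^ (α - 1) - D * v ^ α) := by
    apply intervalIntegral.integral_congr_uIoo
    intro v hv
    rw [Set.uIoo_of_le hu.le] at hv
    have : v ^ α = v ^ (α - 1) * v := by
      rw [← Real.rpow_add_one hv.1.ne']; ring_nf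
    simp only [this]
    ring
  rw [h2, intervalIntegral.integral_sub, intervalIntegral.integral_const_mul,
    intervalIntegral.integral_const_mul, integral_rpow (by left; linarith),
    integral_rpow (by left; linarith), sub_add_cancel, Real.zero_rpow hα.ne',
    Real.zero_rpow (by linarith)]
  · simp
  · exact (intervalIntegral.intervalIntegrable_rpow' (by linarith)).const_mul _
  · exact (intervalIntegral.intervalIntegrable_rpow' (by linarith)).const_mul _

lemma aux_outer (α t A B : ℝ) (hα : 0 < α) (ht : 0 < t) :
    (∫ u in (0:ℝ)..t, ((t * A) * u ^ (2 * α - 1) - (A + t * B) * u ^ (2 * α)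
        + B * u ^ (2 * α + 1))) =
      t * A * (t ^ (2 * α) / (2 * α)) - (A + t * B) * (t ^ (2 * α + 1) / (2 * α + 1))
        + B * (t ^ (2 * α + 2) / (2 * α + 2)) := by
  have i (r c : ℝ) (hr : -1 < r) : IntervalIntegrable (fun u : ℝ => c * u ^ r) volume 0 t :=
    (intervalIntegral.intervalIntegrable_rpow' hr).const_mul _
  rw [intervalIntegral.integral_add ((i _ _ (by linarith)).sub (i _ _ (by linarith)))
      (i _ _ (by linarith)),
    intervalIntegral.integral_sub (i _ _ (by linarith)) (i _ _ (by linarith))]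
  simp only [intervalIntegral.integral_const_mul]
  rw [integral_rpow (by left; linarith), integral_rpow (by left; linarith),
    integral_rpow (by left; linarith), sub_add_cancel, Real.zero_rpow (by linarith),
    Real.zero_rpow (by linarith), Real.zero_rpow (by linarith)]
  rw [show 2 * α + 1 + 1 = 2 * α + 2 by ring]
  simp

theorem gcp_fracint_var (k : ℕ) (hk : 1 ≤ k) (l : Fin k → ℝ) (hl : ∀ j, 0 < l j)
    (c₁ c₂ : ℝ) (hc₁ : c₁ = ∑ j, (j.val + 1 : ℝ) * l j)
    (hc₂ : c₂ = ∑ j, ((j.val + 1 : ℝ)) ^ 2 * l j)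
    (α t : ℝ) (hα : 0 < α) (ht : 0 < t) :
    (2 / (Real.Gamma α) ^ 2) *
        (∫ s in (0 : ℝ)..t, ∫ w in s..t,
          (t - s) ^ (α - 1) * (t - w) ^ (α - 1) * (c₂ * s + c₁ ^ 2 * s * w)) -
        (c₁ * t ^ (α + 1) / Real.Gamma (α + 2)) ^ 2 =
      c₂ * t ^ (2 * α + 1) / ((2 * α + 1) * (Real.Gamma (α + 1)) ^ 2) := by
  clear hc₁ hc₂
  have h1 := intervalIntegral.integral_comp_sub_left (a := 0) (b := t)
    (fun u : ℝ => ∫ w in (t - u)..t,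
          u ^ (α - 1) * (t - w) ^ (α - 1) * (c₂ * (t - u) + c₁ ^ 2 * (t - u) * w)) t
  simp only [sub_sub_cancel, sub_self, sub_zero] at h1
  rw [h1]
  have h2 : (∫ u in (0:ℝ)..t, ∫ w in (t - u)..t,
          u ^ (α - 1) * (t - w) ^ (α - 1) * (c₂ * (t - u) + c₁ ^ 2 * (t - u) * w)) =
      ∫ u in (0:ℝ)..t, ((t * ((c₂ + c₁ ^ 2 * t) / α)) * u ^ (2 * α - 1)
        - ((c₂ + c₁ ^ 2 * t) / α + t * (c₁ ^ 2 / (α + 1))) * u ^ (2 * α)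
        + (c₁ ^ 2 / (α + 1)) * u ^ (2 * α + 1)) := by
    apply intervalIntegral.integral_congr_uIoo
    intro u hu
    rw [Set.uIoo_of_le ht.le] at hu
    have hu0 := hu.1
    simp only [mul_assoc (u ^ (α - 1)), intervalIntegral.integral_const_mul]
    rw [aux_inner α t u _ _ hα hu0]
    have e1 : u ^ α = u ^ (α - 1) * u := by
      rw [← Real.rpow_add_one hu0.ne']; ring_nf
    have e2 : u ^ (α + 1) = u ^ (α - 1) * u * u := by
      rw [Real.rpow_add_one hu0.ne', e1]
    have e3 : u ^ (2 * α - 1) = u ^ (α - 1) * u ^ (α - 1) * u := by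
      rw [← Real.rpow_add hu0, ← Real.rpow_add_one hu0.ne']; ring_nf
    have e4 : u ^ (2 * α) = u ^ (α - 1) * u ^ (α - 1) * u * u := by
      rw [← e3, ← Real.rpow_add_one hu0.ne']; ring_nf
    have e5 : u ^ (2 * α + 1) = u ^ (α - 1) * u ^ (α - 1) * u * u * u := by
      rw [← e4, ← Real.rpow_add_one hu0.ne']
    rw [e1, e2, e3, e4, e5]
    ring
  rw [h2, aux_outer α t _ _ hα ht]
  have g1 : Real.Gamma (α + 1) = α * Real.Gamma α := Real.Gamma_add_one hα.ne'
  have g2 : Real.Gamma (α + 2) = (α + 1) * (α * Real.Gamma α) := by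
    rw [show α + 2 = α + 1 + 1 by ring, Real.Gamma_add_one (by linarith), g1]
  have hG := (Real.Gamma_pos_of_pos hα).ne'
  have e1 : t ^ (α + 1) = t ^ α * t := Real.rpow_add_one ht.ne' _
  have e2 : t ^ (2 * α) = t ^ α * t ^ α := by rw [← Real.rpow_add ht]; ring_nf
  have e3 : t ^ (2 * α + 1) = t ^ α * t ^ α * t := by rw [Real.rpow_add_one ht.ne', e2]
  have e4 : t ^ (2 * α + 2) = t ^ α * t ^ α * t * t := by
    rw [← e3, ← Real.rpow_add_one ht.ne']; ring_nf
  rw [g1, g2, e1, e2, e3, e4]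
  generalize t ^ α = T
  have a1 : α + 1 ≠ 0 := by linarith
  have a2 : 2 * α + 1 ≠ 0 := by linarith
  rw [show 2 * α + 2 = 2 * (α + 1) by ring]
  field_simp
  ring
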